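/- arXiv:2203.05886 — 2 statements merged into one kernel-verified Lean document; each statement's English description precedes it below -/
import Mathlib

section
/- Let a < b be real numbers, ε ∈ (0,1], and λ₁, λ₂ ∈ ℝ. Suppose Φ : [0,∞) × ℝ → ℂ² is twice continuously differentiable, satisfies Φ(t, x + (b−a)) = Φ(t, x) for all t ≥ 0 and x ∈ ℝ, and solves i ∂ₜΦ(t,x) = −i σ₁ ∂ₓΦ(t,x) + σ₃ Φ(t,x) + ε² F(Φ(t,x)) Φ(t,x) for all t > 0 and x ∈ ℝ. Then the energy E(t) := ∫ₐᵇ ( −i Φ(t,x)* σ₁ ∂ₓΦ(t,x) + Φ(t,x)* σ₃ Φ(t,x) + ε² G(Φ(t,x)) ) dx satisfies E(t) = E(0) for every t ≥ 0. -/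
open Matrix MeasureTheory

noncomputable def sigma1 : Matrix (Fin 2) (Fin 2) ℂ := !![0, 1; 1, 0]

noncomputable def sigma3 : Matrix (Fin 2) (Fin 2) ℂ := !![1, 0; 0, -1]

/-- The matrix nonlinearity F(Φ) = λ₁ (Φ*σ₃Φ) σ₃ + λ₂ |Φ|² I₂. -/
noncomputable def Fnl (lam1 lam2 : ℝ) (z : Fin 2 → ℂ) : Matrix (Fin 2) (Fin 2) ℂ :=
  ((lam1 : ℂ) * (star z ⬝ᵥ sigma3.mulVec z)) • sigma3 +
    ((lam2 : ℂ) * (star z ⬝ᵥ z)) • (1 : Matrix (Fin 2) (Fin 2) ℂ)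

/-- The nonlinear energy density G(Φ) = (λ₁/2)(Φ*σ₃Φ)² + (λ₂/2)|Φ|⁴. -/
noncomputable def Gnl (lam1 lam2 : ℝ) (z : Fin 2 → ℂ) : ℂ :=
  ((lam1 : ℂ) / 2) * (star z ⬝ᵥ sigma3.mulVec z) ^ 2 +
    ((lam2 : ℂ) / 2) * (star z ⬝ᵥ z) ^ 2

/-- Energy density in components. -/
noncomputable def eDens (c l1 l2 : ℂ) (p0 p1 x0 x1 : ℂ) : ℂ :=
  -Complex.I * (star p0 * x1 + star p1 * x0) + (star p0 * p0 - star p1 * p1) +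
    c * (l1 / 2 * (star p0 * p0 - star p1 * p1) ^ 2 + l2 / 2 * (star p0 * p0 + star p1 * p1) ^ 2)

/-- Energy flux in components. -/
noncomputable def jFlux (p0 p1 t0 t1 : ℂ) : ℂ :=
  Complex.I * (star p0 * t1 + star p1 * t0)

lemma eDens_deriv (c l1 l2 : ℂ) {p0 p1 x0 x1 : ℝ → ℂ} {p0' p1' x0' x1' : ℂ} {s : ℝ}
    (h0 : HasDerivAt p0 p0' s) (h1 : HasDerivAt p1 p1' s)
    (k0 : HasDerivAt x0 x0' s) (k1 : HasDerivAt x1 x1' s) :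
    HasDerivAt (fun r => eDens c l1 l2 (p0 r) (p1 r) (x0 r) (x1 r))
      (-Complex.I * (star p0' * x1 s + star (p0 s) * x1' + star p1' * x0 s + star (p1 s) * x0') +
        (star p0' * p0 s + star (p0 s) * p0' - star p1' * p1 s - star (p1 s) * p1') +
        c * (l1 * (star (p0 s) * p0 s - star (p1 s) * p1 s) *
            (star p0' * p0 s + star (p0 s) * p0' - star p1' * p1 s - star (p1 s) * p1') +
          l2 * (star (p0 s) * p0 s + star (p1 s) * p1 s) *
            (star p0' * p0 s + star (p0 s) * p0' + star p1' * p1 s + star (p1 s) * p1'))) s := by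
  have a0 := h0.star.mul h0
  have a1 := h1.star.mul h1
  have b0 := h0.star.mul k1
  have b1 := h1.star.mul k0
  have := (((b0.add b1).const_mul (-Complex.I)).add (a0.sub a1)).add
    (((((a0.sub a1).pow 2).const_mul (l1 / 2)).add
      (((a0.add a1).pow 2).const_mul (l2 / 2))).const_mul c)
  refine this.congr_deriv ?_
  simp
  ring

lemma jFlux_deriv {p0 p1 x0 x1 : ℝ → ℂ} {p0' p1' x0' x1' : ℂ} {s : ℝ}
    (h0 : HasDerivAt p0 p0' s) (h1 : HasDerivAt p1 p1' s)
    (k0 : HasDerivAt x0 x0' s) (k1 : HasDerivAt x1 x1' s) :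
    HasDerivAt (fun r => jFlux (p0 r) (p1 r) (x0 r) (x1 r))
      (Complex.I * (star p0' * x1 s + star (p0 s) * x1' + star p1' * x0 s + star (p1 s) * x0'))
      s := by
  have := (((h0.star.mul k1).add (h1.star.mul k0)).const_mul (Complex.I))
  refine this.congr_deriv ?_
  ring

lemma density_balance (c l1 l2 : ℝ) (p0 p1 x0 x1 t0 t1 m0 m1 : ℂ)
    (e0 : Complex.I * t0 = -Complex.I * x1 + p0 +
      c * ((l1 * (star p0 * p0 - star p1 * p1)) * p0 + (l2 * (star p0 * p0 + star p1 * p1)) * p0))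
    (e1 : Complex.I * t1 = -Complex.I * x0 - p1 +
      c * (-(l1 * (star p0 * p0 - star p1 * p1)) * p1 + (l2 * (star p0 * p0 + star p1 * p1)) * p1)) :
      (-Complex.I * (star t0 * x1 + star p0 * m1 + star t1 * x0 + star p1 * m0) +
        (star t0 * p0 + star p0 * t0 - star t1 * p1 - star p1 * t1) +
        c * (l1 * (star p0 * p0 - star p1 * p1) *
            (star t0 * p0 + star p0 * t0 - star t1 * p1 - star p1 * t1) +
          l2 * (star p0 * p0 + star p1 * p1) *
            (star t0 * p0 + star p0 * t0 + star t1 * p1 + star p1 * t1))) +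
      (Complex.I * (star x0 * t1 + star p0 * m1 + star x1 * t0 + star p1 * m0)) = 0 := by
  have f0 := congrArg star e0
  have f1 := congrArg star e1
  simp only [star_add, star_sub, star_mul', star_neg, Complex.star_def, Complex.conj_I,
    Complex.conj_ofReal, Complex.conj_conj] at f0 f1 ⊢
  simp only [Complex.star_def] at e0 e1
  linear_combination -(starRingEnd ℂ t0) * e0 - (starRingEnd ℂ t1) * e1 - t0 * f0 - t1 * f1

/-- Energy conservation for the 1D weakly nonlinear Dirac equation. -/
theorem energy_conservation_NLDE
    (a b : ℝ) (hab : a < b) (ε : ℝ) (hε : ε ∈ Set.Ioc (0 : ℝ) 1) (lam1 lam2 : ℝ)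
    (Φ : ℝ → ℝ → Fin 2 → ℂ)
    (hreg : ContDiffOn ℝ 2 (fun p : ℝ × ℝ => Φ p.1 p.2) (Set.Ici 0 ×ˢ Set.univ))
    (hper : ∀ t : ℝ, 0 ≤ t → ∀ x : ℝ, Φ t (x + (b - a)) = Φ t x)
    (hPDE : ∀ t : ℝ, 0 < t → ∀ x : ℝ,
      Complex.I • deriv (fun s => Φ s x) t =
        (-Complex.I) • sigma1.mulVec (deriv (fun y => Φ t y) x) +
          sigma3.mulVec (Φ t x) +
          ((ε : ℂ) ^ 2) • (Fnl lam1 lam2 (Φ t x)).mulVec (Φ t x))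
    (E : ℝ → ℂ)
    (hE : ∀ t : ℝ, E t = ∫ x in a..b,
      (-Complex.I * (star (Φ t x) ⬝ᵥ sigma1.mulVec (deriv (fun y => Φ t y) x)) +
        star (Φ t x) ⬝ᵥ sigma3.mulVec (Φ t x) +
        ((ε : ℂ) ^ 2) * Gnl lam1 lam2 (Φ t x))) :
    ∀ t : ℝ, 0 ≤ t → E t = E 0 := by
  intro τ hτ
  set S : Set (ℝ × ℝ) := Set.Ici 0 ×ˢ Set.univ with hS
  set f : ℝ × ℝ → Fin 2 → ℂ := fun p => Φ p.1 p.2 with hf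
  have hU : UniqueDiffOn ℝ S := (uniqueDiffOn_Ici 0).prod uniqueDiffOn_univ
  set D := fderivWithin ℝ f S with hD
  have hD1 : ContDiffOn ℝ 1 D S := hreg.fderivWithin hU (by norm_num)
  have hDc : ContinuousOn D S := hD1.continuousOn
  have hfc : ContinuousOn f S := hreg.continuousOn
  have hfD : ∀ p ∈ S, HasFDerivWithinAt f (D p) S p := fun p hp =>
    ((hreg.differentiableOn (by norm_num)) p hp).hasFDerivWithinAt
  have hnhds : ∀ p : ℝ × ℝ, 0 < p.1 → S ∈ nhds p := by
    intro p hp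
    exact prod_mem_nhds (Ici_mem_nhds hp) Filter.univ_mem
  have hfD' : ∀ p : ℝ × ℝ, 0 < p.1 → HasFDerivAt f (D p) p := fun p hp =>
    (hfD p (mem_of_mem_nhds (hnhds p hp))).hasFDerivAt (hnhds p hp)
  have hDD : ∀ p : ℝ × ℝ, 0 < p.1 → HasFDerivAt D (fderiv ℝ D p) p := fun p hp =>
    ((hD1.contDiffAt (hnhds p hp)).differentiableAt (by norm_num)).hasFDerivAt
  have hsymm : ∀ p : ℝ × ℝ, 0 < p.1 → ∀ v w, fderiv ℝ D p v w = fderiv ℝ D p w v := by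
    intro p hp v w
    refine second_derivative_symmetric_of_eventually (f := f) (f' := D) (x := p) ?_ (hDD p hp) v w
    have : ∀ᶠ q : ℝ × ℝ in nhds p, 0 < q.1 :=
      continuous_fst.continuousAt.eventually (lt_mem_nhds hp)
    filter_upwards [this] with q hq using hfD' q hq
  -- partial derivatives
  have hX : ∀ t x : ℝ, 0 ≤ t → deriv (fun y => Φ t y) x = D (t, x) (0, 1) := by
    intro t x ht
    have h1 : HasDerivWithinAt (fun y : ℝ => ((t, y) : ℝ × ℝ)) (0, 1) Set.univ x :=
      (hasDerivWithinAt_const x _ t).prodMk (hasDerivWithinAt_id x _)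
    have h2 := (hfD (t, x) ⟨ht, trivial⟩).comp_hasDerivWithinAt x h1 (fun y _ => ⟨ht, trivial⟩)
    exact (hasDerivWithinAt_univ.1 h2).deriv
  have hT : ∀ t x : ℝ, 0 < t → deriv (fun s => Φ s x) t = D (t, x) (1, 0) := by
    intro t x ht
    have h1 : HasDerivAt (fun s : ℝ => ((s, x) : ℝ × ℝ)) (1, 0) t :=
      (hasDerivAt_id t).prodMk (hasDerivAt_const t x)
    exact ((hfD' (t, x) ht).comp_hasDerivAt t h1).deriv
  set e : ℝ × ℝ → ℂ := fun p => eDens ((ε ^ 2 : ℝ) : ℂ) lam1 lam2 (f p 0) (f p 1)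
    (D p (0, 1) 0) (D p (0, 1) 1) with he
  set J : ℝ × ℝ → ℂ := fun p => jFlux (f p 0) (f p 1) (D p (1, 0) 0) (D p (1, 0) 1) with hJ
  have hEe : ∀ t, 0 ≤ t → E t = ∫ x in a..b, e (t, x) := by
    intro t ht
    rw [hE]
    congr 1
    ext x
    rw [hX t x ht]
    simp [he, eDens, Gnl, sigma1, sigma3, Matrix.mulVec, dotProduct, Fin.sum_univ_two, hf]
    ring
  have hfi : ∀ i, ContinuousOn (fun p => f p i) S := fun i => continuousOn_pi.1 hfc i
  have hDi : ∀ v i, ContinuousOn (fun p => D p v i) S := fun v i =>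
    continuousOn_pi.1 (hDc.clm_apply continuousOn_const) i
  have hec : ContinuousOn e S := by
    have h0 := hfi 0
    have h1 := hfi 1
    have h2 := hDi (0, 1) 0
    have h3 := hDi (0, 1) 1
    simp only [he, eDens]
    fun_prop
  have hJc : ContinuousOn J S := by
    have h0 := hfi 0
    have h1 := hfi 1
    have h2 := hDi (1, 0) 0
    have h3 := hDi (1, 0) 1
    simp only [hJ, jFlux]
    fun_prop
  have hfd : ∀ p : ℝ × ℝ, 0 < p.1 → ∀ i, DifferentiableAt ℝ (fun p => f p i) p := fun p hp i =>
    differentiableAt_pi.1 (hfD' p hp).differentiableAt i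
  have hDd : ∀ p : ℝ × ℝ, 0 < p.1 → ∀ v i, DifferentiableAt ℝ (fun p => D p v i) p :=
    fun p hp v i => differentiableAt_pi.1
      ((hDD p hp).differentiableAt.clm_apply (differentiableAt_const v)) i
  have hed : ∀ p : ℝ × ℝ, 0 < p.1 → DifferentiableAt ℝ e p := by
    intro p hp
    have h0 := hfd p hp 0
    have h1 := hfd p hp 1
    have h2 := hDd p hp (0, 1) 0
    have h3 := hDd p hp (0, 1) 1
    have h4 := h0.star
    have h5 := h1.star
    simp only [he, eDens]
    fun_prop
  have hJd : ∀ p : ℝ × ℝ, 0 < p.1 → DifferentiableAt ℝ J p := by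
    intro p hp
    have h0 := hfd p hp 0
    have h1 := hfd p hp 1
    have h2 := hDd p hp (1, 0) 0
    have h3 := hDd p hp (1, 0) 1
    have h4 := h0.star
    have h5 := h1.star
    simp only [hJ, jFlux]
    fun_prop
  have hfl : ∀ p : ℝ × ℝ, 0 < p.1 → ∀ v i,
      HasDerivAt (fun s : ℝ => f (p + s • v) i) (D p v i) 0 := fun p hp v i =>
    hasDerivAt_pi.1 ((hfD' p hp).hasLineDerivAt v) i
  have hDl : ∀ p : ℝ × ℝ, 0 < p.1 → ∀ v w i,
      HasDerivAt (fun s : ℝ => D (p + s • v) w i) (fderiv ℝ D p v w i) 0 := by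
    intro p hp v w i
    have h := (hDD p hp).hasLineDerivAt v
    have h2 : HasDerivAt (fun s : ℝ => D (p + s • v) w) (fderiv ℝ D p v w) 0 := by
      simpa using HasDerivAt.clm_apply h (hasDerivAt_const (0 : ℝ) w)
    exact hasDerivAt_pi.1 h2 i
  have hbal : ∀ p : ℝ × ℝ, 0 < p.1 → fderiv ℝ e p (1, 0) + fderiv ℝ J p (0, 1) = 0 := by
    intro p hp
    have A := (hed p hp).hasFDerivAt.hasLineDerivAt (1, 0)
    have B := (hJd p hp).hasFDerivAt.hasLineDerivAt (0, 1)
    have A' := eDens_deriv ((ε ^ 2 : ℝ) : ℂ) lam1 lam2 (hfl p hp (1, 0) 0) (hfl p hp (1, 0) 1)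
      (hDl p hp (1, 0) (0, 1) 0) (hDl p hp (1, 0) (0, 1) 1)
    have B' := jFlux_deriv (hfl p hp (0, 1) 0) (hfl p hp (0, 1) 1)
      (hDl p hp (0, 1) (1, 0) 0) (hDl p hp (0, 1) (1, 0) 1)
    rw [HasDerivAt.unique A A', HasDerivAt.unique B B', hsymm p hp (0, 1) (1, 0)]
    simp only [zero_smul, add_zero]
    have P := hPDE p.1 hp p.2
    rw [hT _ _ hp, hX _ _ hp.le] at P
    refine density_balance (ε ^ 2) lam1 lam2 _ _ _ _ _ _ _ _ ?_ ?_
    · have := congrFun P 0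
      simp [Fnl, sigma1, sigma3, Matrix.mulVec, dotProduct, Fin.sum_univ_two] at this
      simp [hf]
      linear_combination this
    · have := congrFun P 1
      simp [Fnl, sigma1, sigma3, Matrix.mulVec, dotProduct, Fin.sum_univ_two] at this
      simp [hf]
      linear_combination this
  have hJper : ∀ t, 0 < t → J (t, b) = J (t, a) := by
    intro t ht
    have h1 : f (t, b) = f (t, a) := by
      have := hper t ht.le a
      simpa [hf] using this
    have h2 : D (t, b) (1, 0) = D (t, a) (1, 0) := by
      rw [← hT t b ht, ← hT t a ht]
      apply Filter.EventuallyEq.deriv_eq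
      filter_upwards [lt_mem_nhds ht] with s hs
      have := hper s (le_of_lt hs) a
      simpa using this
    simp only [hJ, h1, h2]
  classical
  have hsub : Set.uIcc 0 τ ×ˢ Set.uIcc a b ⊆ S := by
    rintro ⟨t, x⟩ ⟨h1, _⟩
    rw [Set.uIcc_of_le hτ] at h1
    exact ⟨h1.1, trivial⟩
  have hpos : ∀ x ∈ (Set.Ioo (min 0 τ) (max 0 τ) ×ˢ Set.Ioo (min a b) (max a b)) \
      (∅ : Set (ℝ × ℝ)), 0 < x.1 := by
    rintro ⟨t, x⟩ ⟨⟨h1, _⟩, _⟩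
    rw [min_eq_left hτ] at h1
    exact h1.1
  have hz : (fun x : ℝ × ℝ => (if 0 < x.1 then fderiv ℝ e x else 0) (1, 0) +
      (if 0 < x.1 then fderiv ℝ J x else 0) (0, 1)) = fun _ => 0 := by
    ext p
    by_cases hp : 0 < p.1
    · simp only [hp, if_true]
      exact hbal p hp
    · simp [hp]
  have key := integral2_divergence_prod_of_hasFDerivAt_off_countable e J
    (fun p => if 0 < p.1 then fderiv ℝ e p else 0) (fun p => if 0 < p.1 then fderiv ℝ J p else 0)
    0 a τ b ∅ Set.countable_empty (hec.mono hsub) (hJc.mono hsub)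
    (fun x hx => by
      simp only [hpos x hx, if_true]
      exact (hed x (hpos x hx)).hasFDerivAt)
    (fun x hx => by
      simp only [hpos x hx, if_true]
      exact (hJd x (hpos x hx)).hasFDerivAt)
    (by rw [hz]; exact integrableOn_zero)
  have hJint : (∫ t in (0 : ℝ)..τ, J (t, b)) = ∫ t in (0 : ℝ)..τ, J (t, a) := by
    apply intervalIntegral.integral_congr_ae
    refine Filter.Eventually.of_forall fun t ht => ?_
    rw [Set.uIoc_of_le hτ] at ht
    exact hJper t ht.1
  have hl : (∫ x in (0 : ℝ)..τ, ∫ y in a..b,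
      ((if 0 < ((x, y) : ℝ × ℝ).1 then fderiv ℝ e (x, y) else 0) (1, 0) +
      (if 0 < ((x, y) : ℝ × ℝ).1 then fderiv ℝ J (x, y) else 0) (0, 1))) = 0 := by
    have : ∀ x y : ℝ, (if 0 < ((x, y) : ℝ × ℝ).1 then fderiv ℝ e (x, y) else 0) (1, 0) +
      (if 0 < ((x, y) : ℝ × ℝ).1 then fderiv ℝ J (x, y) else 0) (0, 1) = 0 :=
      fun x y => congrFun hz (x, y)
    simp only [this, intervalIntegral.integral_zero]
  rw [hEe τ hτ, hEe 0 le_rfl]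
  have k2 := hl.symm.trans key
  rw [hJint] at k2
  linear_combination -k2
end

section
/- Let a < b be real numbers and set μ_l = 2πl/(b−a) and δ_l = √(1+μ_l²) for l ∈ ℤ. Then there exists a constant C > 0, depending only on b−a, such that for all l₁, l₂, l₃ ∈ ℤ with l = l₁ − l₂ + l₃, and all sign choices ν₁, ν₂, ν₃, ν₄ ∈ {−1, +1}, one has (1 + |μ_l|) · |ν₁ δ_l − ν₂ δ_{l₁} + ν₃ δ_{l₂} − ν₄ δ_{l₃}| ≤ C (1+μ_{l₁}²)(1+μ_{l₂}²)(1+μ_{l₃}²). -/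
/-- The Fourier frequencies μ_l = 2πl/(b−a). -/
noncomputable def mu (a b : ℝ) (l : ℤ) : ℝ := 2 * Real.pi * l / (b - a)

/-- The Dirac dispersion frequencies δ_l = √(1+μ_l²). -/
noncomputable def del (a b : ℝ) (l : ℤ) : ℝ := Real.sqrt (1 + mu a b l ^ 2)

theorem del_le_aux (a b : ℝ) (l : ℤ) : del a b l ≤ 1 + |mu a b l| := by
  unfold del
  apply Real.sqrt_le_iff.mpr
  have h := abs_nonneg (mu a b l)
  refine ⟨by linarith, ?_⟩
  nlinarith [sq_abs (mu a b l)]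

theorem abs_sign_del_aux (a b : ℝ) (l : ℤ) (ν : ℝ) (h : ν = 1 ∨ ν = -1) :
    |ν * del a b l| ≤ 1 + |mu a b l| := by
  have h0 : 0 ≤ del a b l := Real.sqrt_nonneg _
  have h1 := del_le_aux a b l
  rcases h with rfl | rfl <;> rw [abs_le] <;> constructor <;> linarith

/-- The resonance frequency δ^{ν₁,ν₂,ν₃,ν₄}_{l,l₁,l₂,l₃} of a cubic interaction
of Fourier modes l₁, l₂, l₃ producing the mode l = l₁ − l₂ + l₃ is controlled,
after multiplication by (1+|μ_l|), by one extra derivative on each input mode. -/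
theorem resonance_frequency_bound (a b : ℝ) (hab : a < b) :
    ∃ C > (0 : ℝ), ∀ (l₁ l₂ l₃ : ℤ) (ν₁ ν₂ ν₃ ν₄ : ℝ),
      (ν₁ = 1 ∨ ν₁ = -1) → (ν₂ = 1 ∨ ν₂ = -1) → (ν₃ = 1 ∨ ν₃ = -1) → (ν₄ = 1 ∨ ν₄ = -1) →
      (1 + |mu a b (l₁ - l₂ + l₃)|) *
          |ν₁ * del a b (l₁ - l₂ + l₃) - ν₂ * del a b l₁ + ν₃ * del a b l₂ - ν₄ * del a b l₃| ≤
        C * (1 + mu a b l₁ ^ 2) * (1 + mu a b l₂ ^ 2) * (1 + mu a b l₃ ^ 2) := by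
  refine ⟨16, by norm_num, ?_⟩
  intro l₁ l₂ l₃ ν₁ ν₂ ν₃ ν₄ h₁ h₂ h₃ h₄
  have e : mu a b (l₁ - l₂ + l₃) = mu a b l₁ - mu a b l₂ + mu a b l₃ := by
    unfold mu; push_cast; ring
  have d := abs_sign_del_aux a b (l₁ - l₂ + l₃) ν₁ h₁
  have d1 := abs_sign_del_aux a b l₁ ν₂ h₂
  have d2 := abs_sign_del_aux a b l₂ ν₃ h₃
  have d3 := abs_sign_del_aux a b l₃ ν₄ h₄
  have t : |mu a b (l₁ - l₂ + l₃)| ≤ |mu a b l₁| + |mu a b l₂| + |mu a b l₃| := by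
    rw [e]
    linarith [abs_add_le (mu a b l₁ - mu a b l₂) (mu a b l₃), abs_sub (mu a b l₁) (mu a b l₂)]
  have s : |ν₁ * del a b (l₁ - l₂ + l₃) - ν₂ * del a b l₁ + ν₃ * del a b l₂ - ν₄ * del a b l₃|
      ≤ 4 * (1 + (|mu a b l₁| + |mu a b l₂| + |mu a b l₃|)) := by
    have := abs_nonneg (mu a b l₁)
    have := abs_nonneg (mu a b l₂)
    have := abs_nonneg (mu a b l₃)
    rw [abs_le] at d d1 d2 d3 ⊢
    constructor <;> linarith
  rw [← sq_abs (mu a b l₁), ← sq_abs (mu a b l₂), ← sq_abs (mu a b l₃)]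
  generalize |mu a b l₁| = x at *
  generalize |mu a b l₂| = y at *
  generalize |mu a b l₃| = z at *
  have t0 := abs_nonneg (mu a b (l₁ - l₂ + l₃))
  calc _ ≤ (1 + (x + y + z)) * (4 * (1 + (x + y + z))) :=
        mul_le_mul (by linarith) s (abs_nonneg _) (by linarith)
    _ ≤ 16 * (1 + x ^ 2 + y ^ 2 + z ^ 2) := by
        nlinarith [sq_nonneg (x - y), sq_nonneg (x - z), sq_nonneg (y - z), sq_nonneg (x - 1),
          sq_nonneg (y - 1), sq_nonneg (z - 1)]
    _ ≤ _ := by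
        have p1 : 0 ≤ x ^ 2 * y ^ 2 := by positivity
        have p2 : 0 ≤ x ^ 2 * z ^ 2 := by positivity
        have p3 : 0 ≤ y ^ 2 * z ^ 2 := by positivity
        have p4 : 0 ≤ x ^ 2 * y ^ 2 * z ^ 2 := by positivity
        nlinarith
end
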